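/- For every δ ∈ (0, δ_max], define Γ̂₊(ŷ;δ) = ŷ·s₊(ŷ;δ) for ŷ ∈ [ŷ_min, 1/2], where s₊(ŷ;δ) is the unique zero of G₊(·,ŷ;δ) in [0,1/2]. Then: (i) ŷ ↦ Γ̂₊(ŷ;δ) is strictly increasing on [ŷ_min, 1/2]; (ii) Γ̂₊(ŷ_min;δ) = m·ŷ_min; (iii) Γ̂max⁺(δ) := Γ̂₊(1/2;δ) satisfies Γ̂max⁺(δ) ∈ [m/2, 3m/4] and δ ↦ Γ̂max⁺(δ) is strictly increasing on (0, δ_max]; (iv) for each Γ̂ ∈ [m·ŷ_min, Γ̂max⁺(δ)] there is a unique ŷ₊(Γ̂;δ) ∈ [ŷ_min, 1/2] with Γ̂₊(ŷ₊(Γ̂;δ);δ) = Γ̂, and Γ̂ ↦ ŷ₊(Γ̂;δ) is strictly increasing. -/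

import Mathlib

noncomputable section
open Real Set

namespace Secular

def U00 : ℝ := 0.762646
def U10 : ℝ := 0.547442
def U20 : ℝ := 0.237353
def mC : ℝ := (-4 + Real.sqrt 21) / 5
def rhoC : ℝ := 1.762157978551987e-18
def muC : ℝ := 398600.44
def aM : ℝ := 384400
def aMin : ℝ := 6378.14
def aMax : ℝ := 30000
def Lmin : ℝ := Real.sqrt (muC * aMin)
def Lmax : ℝ := Real.sqrt (muC * aMax)
def deltaFun (L : ℝ) : ℝ := rhoC * L ^ 10 / (muC ^ 3 * aM ^ 3)
def deltaMax : ℝ := deltaFun Lmax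
def rho0 : ℝ := muC ^ 4 * 1.08e-3 * 6378.14 ^ 2
def rho1 : ℝ := rhoC * rho0
def alphaCube (L : ℝ) : ℝ := L ^ 6 / (muC ^ 3 * aM ^ 3)

def aA (σ : ℝ) : ℝ := 1 - 16 * σ - 20 * σ ^ 2
def bB (σ : ℝ) : ℝ := (2 * σ + 3) * Real.sqrt (3 - 4 * σ - 4 * σ ^ 2)
def cPl (σ : ℝ) : ℝ := U00 / 2 * aA σ + 5 * U10 / 3 * bB σ
def cMi (σ : ℝ) : ℝ := U00 / 2 * aA σ - 5 * U10 / 3 * bB σ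
def Ap (σ δ : ℝ) : ℝ := aA σ + δ * cPl σ
def Am (σ δ : ℝ) : ℝ := aA σ + δ * cMi σ


/-- `a(s) = 5s² + 8s − 1`. -/
def aE (s : ℝ) : ℝ := 5 * s ^ 2 + 8 * s - 1
def bEp (s : ℝ) : ℝ :=
  10 * U00 * s * (1 + s) + 20 * U10 * (3 + s) * s ^ 2 / (3 * Real.sqrt (3 - 2*s - s^2))
def bEm (s : ℝ) : ℝ :=
  10 * U00 * s * (1 + s) - 20 * U10 * (3 + s) * s ^ 2 / (3 * Real.sqrt (3 - 2*s - s^2))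
def cEp (s : ℝ) : ℝ :=
  8 * U00 * (3*s - 1) + 20 * U10 * (3 + s) * (8*s - 12) / (3 * Real.sqrt (3 - 2*s - s^2))
def cEm (s : ℝ) : ℝ :=
  8 * U00 * (3*s - 1) - 20 * U10 * (3 + s) * (8*s - 12) / (3 * Real.sqrt (3 - 2*s - s^2))
def Gp (s yh δ : ℝ) : ℝ := aE s + 2 * δ * (bEp s * yh ^ 3 + cEp s * yh ^ 5)
def Gm (s yh δ : ℝ) : ℝ := aE s + 2 * δ * (bEm s * yh ^ 3 + cEm s * yh ^ 5)

def yHatMin : ℝ := Real.sqrt (-(bEp mC) / cEp mC)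

/-- The algebraic form `√((3+s)/(1-s))` of the radical quotient in `bEp` and `cEp`. -/
def rad (s : ℝ) : ℝ := Real.sqrt ((3 + s) / (1 - s))

lemma div_sqrt_eq_rad {s : ℝ} (h0 : 0 ≤ s) (h1 : s ≤ 1 / 2) :
    (3 + s) / Real.sqrt (3 - 2 * s - s ^ 2) = rad s := by
  have h3 : 0 < 3 + s := by linarith
  have h4 : 0 < 1 - s := by linarith
  have e : 3 - 2 * s - s ^ 2 = (3 + s) * (1 - s) := by ring
  rw [rad, e, Real.sqrt_mul h3.le, Real.sqrt_div h3.le]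
  have hp := Real.sqrt_pos.2 h3
  have hq := Real.sqrt_pos.2 h4
  have := Real.sq_sqrt h3.le
  field_simp
  linarith

lemma bEp_eq {s : ℝ} (h0 : 0 ≤ s) (h1 : s ≤ 1 / 2) :
    bEp s = 10 * U00 * s * (1 + s) + 20 * U10 / 3 * s ^ 2 * rad s := by
  rw [bEp, ← div_sqrt_eq_rad h0 h1]
  ring

lemma cEp_eq {s : ℝ} (h0 : 0 ≤ s) (h1 : s ≤ 1 / 2) :
    cEp s = 8 * U00 * (3 * s - 1) + 20 * U10 / 3 * (8 * s - 12) * rad s := by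
  rw [cEp, ← div_sqrt_eq_rad h0 h1]
  ring

lemma rad_sq {s : ℝ} (h0 : 0 ≤ s) (h1 : s ≤ 1 / 2) : rad s ^ 2 = (3 + s) / (1 - s) :=
  Real.sq_sqrt (div_nonneg (by linarith) (by linarith))

lemma rad_ge {s : ℝ} (h0 : 0 ≤ s) (h1 : s ≤ 1 / 2) : 1.7 ≤ rad s := by
  refine Real.le_sqrt_of_sq_le ?_
  rw [le_div_iff₀ (by linarith)]
  linarith

lemma rad_mono {s t : ℝ} (hst : s ≤ t) (h1 : t ≤ 1 / 2) : rad s ≤ rad t := by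
  refine Real.sqrt_le_sqrt ?_
  rw [div_le_div_iff₀ (by linarith) (by linarith)]
  linarith

lemma rad_sub_le {s t : ℝ} (h0 : 0 ≤ s) (hst : s ≤ t) (h1 : t ≤ 1 / 2) :
    rad t - rad s ≤ 5 * (t - s) := by
  have hs := rad_ge h0 (hst.trans h1)
  have ht := rad_ge (h0.trans hst) h1
  have hm := rad_mono hst h1
  have h : rad t ^ 2 - rad s ^ 2 ≤ 16 * (t - s) := by
    rw [rad_sq h0 (hst.trans h1), rad_sq (h0.trans hst) h1,
      div_sub_div _ _ (by linarith) (by linarith), div_le_iff₀ (mul_pos (by linarith) (by linarith))]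
    have : 1 / 4 ≤ (1 - t) * (1 - s) := by nlinarith
    nlinarith [mul_nonneg (sub_nonneg.2 hst) (sub_nonneg.2 this)]
  nlinarith [mul_nonneg (sub_nonneg.2 hm) (show 0 ≤ rad t + rad s - 3.4 by linarith)]

lemma bEp_mono {s t : ℝ} (h0 : 0 ≤ s) (hst : s ≤ t) (h1 : t ≤ 1 / 2) : bEp s ≤ bEp t := by
  have hm := rad_mono hst h1
  have hs := rad_ge h0 (hst.trans h1)
  rw [bEp_eq h0 (hst.trans h1), bEp_eq (h0.trans hst) h1]
  have h2 : s ^ 2 * rad s ≤ t ^ 2 * rad t := by gcongr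
  have h3 : s * (1 + s) ≤ t * (1 + t) := by nlinarith
  norm_num [U00, U10]
  linarith

lemma cEp_sub_ge {s t : ℝ} (h0 : 0 ≤ s) (hst : s ≤ t) (h1 : t ≤ 1 / 2) :
    -(300 * (t - s)) ≤ cEp t - cEp s := by
  have hm := rad_mono hst h1
  have ht := rad_ge (h0.trans hst) h1
  have hl := rad_sub_le h0 hst h1
  rw [cEp_eq h0 (hst.trans h1), cEp_eq (h0.trans hst) h1]
  have h2 : -(60 * (t - s)) ≤ (8 * t - 12) * rad t - (8 * s - 12) * rad s := by
    nlinarith [mul_nonneg (sub_nonneg.2 hst) (show 0 ≤ rad t by linarith),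
      mul_nonneg h0 (sub_nonneg.2 hm)]
  norm_num [U00, U10]
  linarith

lemma bEp_pos {s : ℝ} (h0 : 0 < s) (h1 : s ≤ 1 / 2) : 0 < bEp s := by
  have := rad_ge h0.le h1
  have : 0 < rad s := by linarith
  rw [bEp_eq h0.le h1, U00, U10]
  positivity

lemma cEp_neg {s : ℝ} (h0 : 0 ≤ s) (h1 : s ≤ 1 / 2) : cEp s < 0 := by
  have := rad_ge h0 h1
  have : (8 * s - 12) * rad s ≤ -8 * 1.7 := by nlinarith
  rw [cEp_eq h0 h1]
  norm_num [U00, U10] at *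
  linarith

lemma bEp_add_cEp_neg {s : ℝ} (h0 : 0 ≤ s) (h1 : s ≤ 1 / 2) : bEp s + cEp s / 4 < 0 := by
  have := rad_ge h0 h1
  have h2 : s ^ 2 ≤ 1 / 4 := by nlinarith
  have : (s ^ 2 + 2 * s - 3) * rad s ≤ -(7 / 4) * 1.7 := by nlinarith
  rw [bEp_eq h0 h1, cEp_eq h0 h1]
  norm_num [U00, U10] at *
  nlinarith

lemma deltaMax_le : deltaMax ≤ 0.11982 := by
  have h : Lmax ^ 10 = (muC * aMax) ^ 5 := by
    rw [show Lmax ^ 10 = (Lmax ^ 2) ^ 5 by ring, Lmax,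
      Real.sq_sqrt (by norm_num [muC, aMax])]
  rw [deltaMax, deltaFun, h]
  norm_num [muC, aMax, rhoC, aM]

lemma mC_bounds : 0.1165 < mC ∧ mC < 0.11652 := by
  have h1 : 4.5825 < Real.sqrt 21 := Real.lt_sqrt_of_sq_lt (by norm_num)
  have h2 : Real.sqrt 21 < 4.5826 := by
    rw [Real.sqrt_lt' (by norm_num)]
    norm_num
  rw [mC]
  constructor <;> linarith

lemma aE_mC : aE mC = 0 := by
  have := Real.sq_sqrt (show (0 : ℝ) ≤ 21 by norm_num)
  rw [aE, mC]
  linarith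

lemma Gp_strictMono {s t y δ : ℝ} (hδ : δ ∈ Set.Ioc (0 : ℝ) deltaMax)
    (hy : y ∈ Set.Ioc (0 : ℝ) (1 / 2)) (h0 : 0 ≤ s) (hst : s < t) (h1 : t ≤ 1 / 2) :
    Gp s y δ < Gp t y δ := by
  obtain ⟨hy0, hy1⟩ := hy
  have hδ0 := hδ.1
  have hδ1 : δ ≤ 0.12 := by linarith [hδ.2, deltaMax_le]
  have h3 : 0 ≤ 2 * δ * y ^ 3 * (bEp t - bEp s) :=
    mul_nonneg (by positivity) (sub_nonneg.2 (bEp_mono h0 hst.le h1))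
  have h5 : y ^ 5 ≤ 1 / 32 := by
    calc y ^ 5 ≤ (1 / 2) ^ 5 := by gcongr
      _ = 1 / 32 := by norm_num
  have h6 : 2 * δ * y ^ 5 ≤ 2 * 0.12 * (1 / 32) := by gcongr
  have h7 : 0 ≤ 2 * δ * y ^ 5 := by positivity
  have hc := mul_le_mul_of_nonneg_left (cEp_sub_ge h0 hst.le h1) h7
  have ha : 8 * (t - s) ≤ aE t - aE s := by
    rw [aE, aE]
    nlinarith
  have hd := mul_le_mul_of_nonneg_right h6 (sub_nonneg.2 hst.le)
  simp only [Gp]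
  norm_num at *
  linarith

lemma lt_of_Gp_lt {s t y δ : ℝ} (hδ : δ ∈ Set.Ioc (0 : ℝ) deltaMax)
    (hy : y ∈ Set.Ioc (0 : ℝ) (1 / 2)) (hs : s ≤ 1 / 2) (ht : 0 ≤ t)
    (h : Gp s y δ < Gp t y δ) : s < t := by
  by_contra! hts
  rcases hts.eq_or_lt with rfl | hlt
  · exact lt_irrefl _ h
  · exact lt_asymm h (Gp_strictMono hδ hy ht hlt hs)

lemma eq_of_Gp_eq {s t y δ : ℝ} (hδ : δ ∈ Set.Ioc (0 : ℝ) deltaMax)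
    (hy : y ∈ Set.Ioc (0 : ℝ) (1 / 2)) (hs : s ∈ Set.Icc (0 : ℝ) (1 / 2))
    (ht : t ∈ Set.Icc (0 : ℝ) (1 / 2)) (h : Gp s y δ = Gp t y δ) : s = t := by
  rcases lt_trichotomy s t with hlt | heq | hlt
  · exact absurd h (Gp_strictMono hδ hy hs.1 hlt ht.2).ne
  · exact heq
  · exact absurd h (Gp_strictMono hδ hy ht.1 hlt hs.2).ne'

lemma aE_nonneg {s : ℝ} (h : mC ≤ s) : 0 ≤ aE s := by
  have h1 := aE_mC
  have h2 := mC_bounds.1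
  rw [aE] at *
  norm_num at h2
  nlinarith

lemma aE_pos {s : ℝ} (h : mC < s) : 0 < aE s := by
  have h1 := aE_mC
  have h2 := mC_bounds.1
  rw [aE] at *
  norm_num at h2
  nlinarith

lemma mC_mem : mC ∈ Set.Icc (0 : ℝ) (1 / 2) := by
  have h := mC_bounds
  norm_num at h
  constructor <;> linarith

lemma mC_pos : 0 < mC := lt_trans (by norm_num) mC_bounds.1

lemma yHatMin_sq : yHatMin ^ 2 = -bEp mC / cEp mC :=
  Real.sq_sqrt (div_nonneg_of_nonpos (by linarith [bEp_pos mC_pos mC_mem.2])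
    (cEp_neg mC_mem.1 mC_mem.2).le)

lemma yHatMin_mem : yHatMin ∈ Set.Ioc (0 : ℝ) (1 / 2) := by
  have hb := bEp_pos mC_pos mC_mem.2
  have hc := cEp_neg mC_mem.1 mC_mem.2
  refine ⟨Real.sqrt_pos.2 (div_pos_of_neg_of_neg (by linarith) hc), ?_⟩
  rw [yHatMin, Real.sqrt_le_left (by norm_num), div_le_iff_of_neg hc]
  linarith [bEp_add_cEp_neg mC_mem.1 mC_mem.2]

lemma bEp_add_cEp_yHatMin : bEp mC + cEp mC * yHatMin ^ 2 = 0 := by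
  rw [yHatMin_sq, mul_div_cancel₀ _ (cEp_neg mC_mem.1 mC_mem.2).ne]
  ring

lemma Gp_eq (s y δ : ℝ) : Gp s y δ = aE s + 2 * δ * (y ^ 3 * (bEp s + cEp s * y ^ 2)) := by
  rw [Gp]
  ring

lemma Gp_mC_yHatMin (δ : ℝ) : Gp mC yHatMin δ = 0 := by
  rw [Gp_eq, aE_mC, bEp_add_cEp_yHatMin]
  ring

lemma Gp_mC_nonpos {y δ : ℝ} (hδ : 0 < δ) (hy : yHatMin ≤ y) : Gp mC y δ ≤ 0 := by
  have hy0 := yHatMin_mem.1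
  have hc := cEp_neg mC_mem.1 mC_mem.2
  have hsq : yHatMin ^ 2 ≤ y ^ 2 := by gcongr
  have h : bEp mC + cEp mC * y ^ 2 ≤ 0 := by
    nlinarith [bEp_add_cEp_yHatMin, mul_le_mul_of_nonpos_left hsq hc.le]
  have hy3 : 0 ≤ y ^ 3 := pow_nonneg (hy0.le.trans hy) 3
  rw [Gp_eq, aE_mC, zero_add]
  exact mul_nonpos_of_nonneg_of_nonpos (by positivity) (mul_nonpos_of_nonneg_of_nonpos hy3 h)

lemma Gp_half (s δ : ℝ) : Gp s (1 / 2) δ = aE s + δ / 4 * (bEp s + cEp s / 4) := by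
  rw [Gp]
  ring

lemma Gp_mC_half_neg {δ : ℝ} (hδ : 0 < δ) : Gp mC (1 / 2) δ < 0 := by
  rw [Gp_half, aE_mC, zero_add]
  exact mul_neg_of_pos_of_neg (by positivity) (bEp_add_cEp_neg mC_mem.1 mC_mem.2)

lemma rad_le_of_le {s : ℝ} (h1 : s ≤ 0.17478) : rad s ≤ 1.962 := by
  rw [rad, Real.sqrt_le_left (by norm_num), div_le_iff₀ (by linarith)]
  norm_num at *
  linarith

lemma Gp_three_halves_mC_half_nonneg {δ : ℝ} (hδ : δ ∈ Set.Ioc (0 : ℝ) deltaMax) :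
    0 ≤ Gp (3 / 2 * mC) (1 / 2) δ := by
  obtain ⟨hl, hu⟩ := mC_bounds
  have ha : aE (3 / 2 * mC) = 5 / 4 - 6 * mC := by
    have := aE_mC
    rw [aE] at *
    linarith
  have hδ1 := hδ.2.trans deltaMax_le
  have hs0 : 0 ≤ 3 / 2 * mC := by linarith [mC_pos]
  have hs1 : 3 / 2 * mC ≤ 0.17478 := by norm_num at *; linarith
  have hs2 : 3 / 2 * mC ≤ 1 / 2 := by norm_num at *; linarith
  have hr := rad_le_of_le hs1
  have hneg := bEp_add_cEp_neg hs0 hs2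
  have hge : -18.1 ≤ bEp (3 / 2 * mC) + cEp (3 / 2 * mC) / 4 := by
    have hl' : 0.17475 ≤ 3 / 2 * mC := by norm_num at *; linarith
    rw [bEp_eq hs0 hs2, cEp_eq hs0 hs2]
    generalize 3 / 2 * mC = s at *
    have hsq : 0.17475 ^ 2 ≤ s ^ 2 := by gcongr
    have hk : -2.6200 * 1.962 ≤ (s ^ 2 + 2 * s - 3) * rad s := by
      have := rad_ge hs0 hs2
      norm_num at *
      nlinarith
    norm_num [U00, U10] at *
    linarith
  rw [Gp_half, ha]
  have := mul_le_mul_of_nonpos_right hδ1 hneg.le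
  norm_num at *
  linarith

lemma Gp_neg_of_lt {s y z δ : ℝ} (hδ : 0 < δ) (hs : s ∈ Set.Icc (0 : ℝ) (1 / 2)) (hm : mC ≤ s)
    (hy : 0 < y) (hyz : y < z) (h : Gp s y δ = 0) : Gp s z δ < 0 := by
  have ha := aE_nonneg hm
  have hc := cEp_neg hs.1 hs.2
  rw [Gp_eq] at *
  have h3 : y ^ 3 < z ^ 3 := by gcongr
  have h2 : y ^ 2 < z ^ 2 := by gcongr
  have hy3 : 0 < y ^ 3 := by positivity
  have hA : y ^ 3 * (bEp s + cEp s * y ^ 2) ≤ 0 := by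
    by_contra! hp
    have := mul_pos (mul_pos two_pos hδ) hp
    linarith
  have hB : bEp s + cEp s * y ^ 2 ≤ 0 := by
    by_contra! hp
    exact absurd (mul_pos hy3 hp) hA.not_gt
  have hC := mul_lt_mul_of_neg_left h2 hc
  have hD : z ^ 3 * (bEp s + cEp s * z ^ 2) < y ^ 3 * (bEp s + cEp s * y ^ 2) := by
    nlinarith
  have := mul_lt_mul_of_pos_left hD (mul_pos two_pos hδ)
  linarith

lemma continuousOn_Gp_div (Γ δ : ℝ) (S : Set ℝ) (hS : ∀ y ∈ S, 0 < y ∧ 0 ≤ Γ / y ∧ Γ / y ≤ 1 / 2) :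
    ContinuousOn (fun y => Gp (Γ / y) y δ) S := by
  have hy : ∀ y ∈ S, y ≠ 0 := fun y h => (hS y h).1.ne'
  have hw : ∀ y ∈ S, 3 * Real.sqrt (3 - 2 * (Γ / y) - (Γ / y) ^ 2) ≠ 0 := fun y h => by
    obtain ⟨_, h0, h1⟩ := hS y h
    have : 0 < 3 - 2 * (Γ / y) - (Γ / y) ^ 2 := by nlinarith
    positivity
  simp only [Gp, aE, bEp, cEp]
  fun_prop (disch := assumption)

section Root

variable {f : ℝ → ℝ} {δ : ℝ}

lemma mC_le_root (hδ : δ ∈ Set.Ioc (0 : ℝ) deltaMax) {s y : ℝ} (hy : y ∈ Set.Icc yHatMin (1 / 2))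
    (hs : s ∈ Set.Icc (0 : ℝ) (1 / 2)) (h : Gp s y δ = 0) : mC ≤ s := by
  by_contra! hlt
  have := Gp_strictMono hδ ⟨yHatMin_mem.1.trans_le hy.1, hy.2⟩ hs.1 hlt mC_mem.2
  linarith [Gp_mC_nonpos hδ.1 hy.1]

lemma strictMonoOn_mul_root (hδ : δ ∈ Set.Ioc (0 : ℝ) deltaMax)
    (hf : ∀ y ∈ Set.Ioc (0 : ℝ) (1 / 2), f y ∈ Set.Icc (0 : ℝ) (1 / 2) ∧ Gp (f y) y δ = 0) :
    StrictMonoOn (fun y => y * f y) (Set.Icc yHatMin (1 / 2)) := by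
  intro y hy z hz hyz
  have hy0 : 0 < y := yHatMin_mem.1.trans_le hy.1
  have hz' : z ∈ Set.Ioc (0 : ℝ) (1 / 2) := ⟨hy0.trans hyz, hz.2⟩
  obtain ⟨hfy, hGy⟩ := hf y ⟨hy0, hy.2⟩
  obtain ⟨hfz, hGz⟩ := hf z hz'
  have hm := mC_le_root hδ hy hfy hGy
  have hlt : f y < f z := lt_of_Gp_lt hδ hz' hfy.2 hfz.1 <| by
    rw [hGz]
    exact Gp_neg_of_lt hδ.1 hfy hm hy0 hyz hGy
  have := mC_pos
  exact mul_lt_mul hyz hlt.le (by linarith) hz'.1.le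

lemma exists_mul_root_eq (hδ : δ ∈ Set.Ioc (0 : ℝ) deltaMax)
    (hf : ∀ y ∈ Set.Ioc (0 : ℝ) (1 / 2), f y ∈ Set.Icc (0 : ℝ) (1 / 2) ∧ Gp (f y) y δ = 0)
    {Γ : ℝ} (hΓ : Γ ∈ Set.Icc (mC * yHatMin) (1 / 2 * f (1 / 2))) :
    ∃ y ∈ Set.Icc yHatMin (1 / 2), y * f y = Γ := by
  obtain ⟨hy0, hy1⟩ := yHatMin_mem
  have hhalf : (1 / 2 : ℝ) ∈ Set.Ioc (0 : ℝ) (1 / 2) := by norm_num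
  obtain ⟨hs, hG⟩ := hf _ hhalf
  have hΓ0 : 0 < Γ := (mul_pos mC_pos hy0).trans_le hΓ.1
  have hΓ1 : 2 * Γ ≤ f (1 / 2) := by linarith [hΓ.2]
  set a := max yHatMin (2 * Γ) with ha
  have ha1 : a ≤ 1 / 2 := max_le hy1 (hΓ1.trans hs.2)
  have hya : yHatMin ≤ a := le_max_left _ _
  have hdom : ∀ y ∈ Set.Icc a (1 / 2), 0 < y ∧ 0 ≤ Γ / y ∧ Γ / y ≤ 1 / 2 := fun y hy => by
    have hypos : 0 < y := hy0.trans_le (hya.trans hy.1)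
    refine ⟨hypos, by positivity, ?_⟩
    rw [div_le_iff₀ hypos]
    linarith [(le_max_right yHatMin (2 * Γ)).trans hy.1]
  have hmono : ∀ {s t y : ℝ}, y ∈ Set.Ioc (0 : ℝ) (1 / 2) → 0 ≤ s → s ≤ t → t ≤ 1 / 2 →
      Gp s y δ ≤ Gp t y δ := fun {s t y} hy h0 hst h1 => by
    rcases hst.eq_or_lt with rfl | hlt
    · exact le_rfl
    · exact (Gp_strictMono hδ hy h0 hlt h1).le
  have hr : Gp (Γ / (1 / 2)) (1 / 2) δ ≤ 0 := by
    rw [← hG]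
    exact hmono hhalf (by positivity) (by linarith) hs.2
  have hl : 0 ≤ Gp (Γ / a) a δ := by
    have haI : a ∈ Set.Ioc (0 : ℝ) (1 / 2) := ⟨hy0.trans_le hya, ha1⟩
    have hle := (hdom a ⟨le_rfl, ha1⟩).2.2
    rcases le_total yHatMin (2 * Γ) with h | h
    · rw [max_eq_right h] at ha
      have : Γ / a = 1 / 2 := by
        rw [ha]
        field_simp
      rw [this, ← (hf a haI).2]
      exact hmono haI (hf a haI).1.1 (hf a haI).1.2 le_rfl
    · rw [max_eq_left h] at ha
      rw [ha] at hle haI ⊢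
      rw [← Gp_mC_yHatMin δ]
      exact hmono haI mC_mem.1 ((le_div_iff₀ hy0).2 hΓ.1) hle
  obtain ⟨y, hy, hyG⟩ := intermediate_value_Icc' ha1 (continuousOn_Gp_div Γ δ _ hdom) ⟨hr, hl⟩
  obtain ⟨hypos, hd⟩ := hdom y hy
  have hyI : y ∈ Set.Ioc (0 : ℝ) (1 / 2) := ⟨hypos, hy.2⟩
  refine ⟨y, ⟨hya.trans hy.1, hy.2⟩, ?_⟩
  rw [eq_of_Gp_eq hδ hyI (hf y hyI).1 hd ((hf y hyI).2.trans hyG.symm)]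
  field_simp

lemma root_half_bounds (hδ : δ ∈ Set.Ioc (0 : ℝ) deltaMax) {s : ℝ}
    (hs : s ∈ Set.Icc (0 : ℝ) (1 / 2)) (h : Gp s (1 / 2) δ = 0) : mC < s ∧ s ≤ 3 / 2 * mC := by
  have hhalf : (1 / 2 : ℝ) ∈ Set.Ioc (0 : ℝ) (1 / 2) := by norm_num
  refine ⟨lt_of_Gp_lt hδ hhalf mC_mem.2 hs.1 (h ▸ Gp_mC_half_neg hδ.1), ?_⟩
  by_contra! hlt
  have := Gp_strictMono hδ hhalf (by linarith [mC_pos]) hlt hs.2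
  linarith [Gp_three_halves_mC_half_nonneg hδ]

end Root

/-- properties of `Γ̂₊(ŷ;δ) = ŷ·s₊(ŷ;δ)`, where `s₊(ŷ;δ)` is the unique zero of
`G₊(·,ŷ;δ)` in `[0,1/2]`:  strict monotonicity in `ŷ`, value at `ŷ_min`, range and strict
monotonicity in `δ` of `Γ̂max⁺(δ) = Γ̂₊(1/2;δ)`, and the strictly increasing inverse `ŷ₊(·;δ)`. -/
theorem stmt6 (sp : ℝ → ℝ → ℝ)
    (hsp : ∀ δ ∈ Set.Ioc (0:ℝ) deltaMax, ∀ yh ∈ Set.Ioc (0:ℝ) (1/2),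
      sp yh δ ∈ Set.Icc (0:ℝ) (1/2) ∧ Gp (sp yh δ) yh δ = 0) :
    (∀ δ ∈ Set.Ioc (0:ℝ) deltaMax,
      StrictMonoOn (fun yh => yh * sp yh δ) (Set.Icc yHatMin (1/2)) ∧
      yHatMin * sp yHatMin δ = mC * yHatMin ∧
      (1/2) * sp (1/2) δ ∈ Set.Icc (mC / 2) (3 * mC / 4) ∧
      (∀ Γh ∈ Set.Icc (mC * yHatMin) ((1/2) * sp (1/2) δ),
        ∃! yh, yh ∈ Set.Icc yHatMin (1/2) ∧ yh * sp yh δ = Γh) ∧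
      (∀ yp : ℝ → ℝ,
        (∀ Γh ∈ Set.Icc (mC * yHatMin) ((1/2) * sp (1/2) δ),
          yp Γh ∈ Set.Icc yHatMin (1/2) ∧ yp Γh * sp (yp Γh) δ = Γh) →
        StrictMonoOn yp (Set.Icc (mC * yHatMin) ((1/2) * sp (1/2) δ)))) ∧
    StrictMonoOn (fun δ => (1/2) * sp (1/2) δ) (Set.Ioc 0 deltaMax) := by
  have hhalf : (1 / 2 : ℝ) ∈ Set.Ioc (0 : ℝ) (1 / 2) := by norm_num
  refine ⟨fun δ hδ => ?_, fun δ hδ ε hε hlt => ?_⟩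
  · have hf := hsp δ hδ
    have hmono := strictMonoOn_mul_root (f := fun y => sp y δ) hδ hf
    have hmin := hf _ yHatMin_mem
    have hb := root_half_bounds hδ (hf _ hhalf).1 (hf _ hhalf).2
    refine ⟨hmono, ?_, ⟨by linarith, by linarith⟩, fun Γ hΓ => ?_, fun yp hyp Γ hΓ Δ hΔ hlt => ?_⟩
    · rw [eq_of_Gp_eq hδ yHatMin_mem hmin.1 mC_mem (hmin.2.trans (Gp_mC_yHatMin δ).symm), mul_comm]
    · obtain ⟨y, hy, hyΓ⟩ := exists_mul_root_eq (f := fun y => sp y δ) hδ hf hΓ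
      exact ⟨y, ⟨hy, hyΓ⟩, fun z hz => hmono.injOn hz.1 hy (hz.2.trans hyΓ.symm)⟩
    · obtain ⟨hy, hyΓ⟩ := hyp Γ hΓ
      obtain ⟨hz, hzΔ⟩ := hyp Δ hΔ
      refine (hmono.lt_iff_lt hy hz).1 ?_
      simpa only [hyΓ, hzΔ] using hlt
  · obtain ⟨hs, hG⟩ := hsp δ hδ _ hhalf
    obtain ⟨ht, hG'⟩ := hsp ε hε _ hhalf
    have hpos := aE_pos (root_half_bounds hδ hs hG).1
    have hneg := bEp_add_cEp_neg hs.1 hs.2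
    have : sp (1 / 2) δ < sp (1 / 2) ε := lt_of_Gp_lt hε hhalf hs.2 ht.1 <| by
      rw [hG']
      rw [Gp_half] at hG ⊢
      linarith [mul_lt_mul_of_neg_right hlt hneg]
    simpa using this

end Secular
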